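/- (Local a posteriori row-space error bound, conservative Galerkin.) Under the stated hypotheses, with ζ_G := ‖Σ_G⁻¹ U_Gᵀ C̄‖, the component of the state-space error in the row space of the constraints satisfies ‖V̄_Gᵀ e^n‖ ≤ Σ_{ℓ=0}^k ε_ℓ ( κ ‖Z̄_Gᵀ e^{n−ℓ}‖ + ζ_G ‖(I_N − P_G) f(x_0 + Φ x̂^{n−ℓ}, t^{n−ℓ})‖ ) + Σ_{ℓ=1}^k γ_ℓ ‖V̄_Gᵀ e^{n−ℓ}‖. -/

import Mathlib

open Matrix Finset

noncomputable def euclNorm {n : ℕ} (v : Fin n → ℝ) : ℝ := Real.sqrt (∑ i, v i ^ 2)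

noncomputable def matNorm {m n : ℕ} (M : Matrix (Fin m) (Fin n) ℝ) : ℝ :=
  ‖LinearMap.toContinuousLinearMap (Matrix.toEuclideanLin M)‖

theorem euclNorm_eq_norm_toLp {n : ℕ} (v : Fin n → ℝ) : euclNorm v = ‖WithLp.toLp 2 v‖ := by
  simp [euclNorm, EuclideanSpace.norm_eq]

theorem euclNorm_nonneg {n : ℕ} (v : Fin n → ℝ) : 0 ≤ euclNorm v := Real.sqrt_nonneg _

theorem euclNorm_add_le {n : ℕ} (v w : Fin n → ℝ) :
    euclNorm (v + w) ≤ euclNorm v + euclNorm w := by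
  simpa only [euclNorm_eq_norm_toLp, WithLp.toLp_add] using norm_add_le _ _

theorem euclNorm_sub_le {n : ℕ} (v w : Fin n → ℝ) :
    euclNorm (v - w) ≤ euclNorm v + euclNorm w := by
  simpa only [euclNorm_eq_norm_toLp, WithLp.toLp_sub] using norm_sub_le _ _

theorem euclNorm_smul {n : ℕ} (c : ℝ) (v : Fin n → ℝ) : euclNorm (c • v) = |c| * euclNorm v := by
  simp only [euclNorm_eq_norm_toLp, WithLp.toLp_smul, norm_smul, Real.norm_eq_abs]

theorem euclNorm_sum_le {ι : Type*} {n : ℕ} (s : Finset ι) (v : ι → Fin n → ℝ) :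
    euclNorm (∑ i ∈ s, v i) ≤ ∑ i ∈ s, euclNorm (v i) := by
  simpa only [euclNorm_eq_norm_toLp, WithLp.toLp_sum] using norm_sum_le _ _

theorem euclNorm_sq {n : ℕ} (v : Fin n → ℝ) : euclNorm v ^ 2 = v ⬝ᵥ v := by
  rw [euclNorm, Real.sq_sqrt (by positivity)]
  simp [dotProduct, sq]

theorem euclNorm_mulVec_le {m n : ℕ} (M : Matrix (Fin m) (Fin n) ℝ) (v : Fin n → ℝ) :
    euclNorm (M *ᵥ v) ≤ matNorm M * euclNorm v := by
  simpa [euclNorm_eq_norm_toLp, matNorm] using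
    (LinearMap.toContinuousLinearMap (Matrix.toEuclideanLin M)).le_opNorm (WithLp.toLp 2 v)

theorem euclNorm_sq_eq_of_mul_transpose_add {n r s : ℕ} {V : Matrix (Fin n) (Fin r) ℝ}
    {Z : Matrix (Fin n) (Fin s) ℝ} (hVZ : V * Vᵀ + Z * Zᵀ = 1) (v : Fin n → ℝ) :
    euclNorm v ^ 2 = euclNorm (Vᵀ *ᵥ v) ^ 2 + euclNorm (Zᵀ *ᵥ v) ^ 2 := by
  have hM : ∀ {l : ℕ} (M : Matrix (Fin n) (Fin l) ℝ),
      (Mᵀ *ᵥ v) ⬝ᵥ (Mᵀ *ᵥ v) = v ⬝ᵥ ((M * Mᵀ) *ᵥ v) := by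
    intro l M
    rw [← mulVec_mulVec, dotProduct_mulVec v, ← mulVec_transpose]
  rw [euclNorm_sq, euclNorm_sq, euclNorm_sq, hM, hM, ← dotProduct_add, ← add_mulVec, hVZ,
    one_mulVec]

/-- A solution of a linear multistep relation whose forcing is controlled by the solution itself
is bounded by its history and the remaining forcing. -/
theorem euclNorm_le_of_multistep {n k : ℕ} {α β : ℕ → ℝ} {κ Δt : ℝ} (hΔt : 0 ≤ Δt)
    (hstab : |β 0| * κ * Δt < |α 0|) {w q : ℕ → Fin n → ℝ} {b : ℕ → ℝ}
    (hw : α 0 • w 0 = (β 0 * Δt) • q 0 + ∑ ℓ ∈ Icc 1 k, ((β ℓ * Δt) • q ℓ - α ℓ • w ℓ))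
    (hq : ∀ ℓ, euclNorm (q ℓ) ≤ κ * euclNorm (w ℓ) + b ℓ) :
    euclNorm (w 0) ≤ ∑ ℓ ∈ range (k + 1), |β ℓ| * Δt / (|α 0| - |β 0| * κ * Δt) * b ℓ
      + ∑ ℓ ∈ Icc 1 k,
        (|α ℓ| + |β ℓ| * κ * Δt) / (|α 0| - |β 0| * κ * Δt) * euclNorm (w ℓ) := by
  have hforce : ∀ ℓ, euclNorm ((β ℓ * Δt) • q ℓ) ≤
      |β ℓ| * Δt * (κ * euclNorm (w ℓ) + b ℓ) := fun ℓ ↦ by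
    rw [euclNorm_smul, abs_mul, abs_of_nonneg hΔt]
    gcongr
    exact hq ℓ
  have hmain : |α 0| * euclNorm (w 0) ≤ |β 0| * Δt * (κ * euclNorm (w 0) + b 0)
      + ∑ ℓ ∈ Icc 1 k, (|β ℓ| * Δt * (κ * euclNorm (w ℓ) + b ℓ) + |α ℓ| * euclNorm (w ℓ)) := by
    rw [← euclNorm_smul, hw]
    refine (euclNorm_add_le _ _).trans (add_le_add (hforce 0) ?_)
    refine (euclNorm_sum_le _ _).trans (sum_le_sum fun ℓ _ ↦ ?_)
    refine (euclNorm_sub_le _ _).trans (add_le_add (hforce ℓ) (euclNorm_smul _ _).le)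
  have hsplit : ∑ ℓ ∈ Icc 1 k,
      (|β ℓ| * Δt * (κ * euclNorm (w ℓ) + b ℓ) + |α ℓ| * euclNorm (w ℓ)) =
      ∑ ℓ ∈ Icc 1 k, |β ℓ| * Δt * b ℓ
        + ∑ ℓ ∈ Icc 1 k, (|α ℓ| + |β ℓ| * κ * Δt) * euclNorm (w ℓ) := by
    rw [← sum_add_distrib]
    exact sum_congr rfl fun ℓ _ ↦ by ring
  have hrange : ∑ ℓ ∈ range (k + 1), |β ℓ| * Δt * b ℓ =
      |β 0| * Δt * b 0 + ∑ ℓ ∈ Icc 1 k, |β ℓ| * Δt * b ℓ := by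
    rw [range_eq_Ico, sum_eq_sum_Ico_succ_bot k.succ_pos]
    rfl
  simp only [div_mul_eq_mul_div, ← sum_div, ← add_div]
  rw [le_div_iff₀ (sub_pos.2 hstab), hrange]
  linarith

/-- Local a posteriori error bound for the component of the conservative
Galerkin state-space error in the row space of the constraints. -/
theorem conservative_galerkin_rowspace_error_bound
    (N Nb p k : ℕ) (hN : 0 < N) (hNb : 0 < Nb) (hp : 0 < p) (hk : 1 ≤ k)
    (Φ : Matrix (Fin N) (Fin p) ℝ) (hΦ : Φᵀ * Φ = 1)
    (C : Matrix (Fin Nb) (Fin N) ℝ)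
    (Δt : ℝ) (hΔt : 0 < Δt)
    (α β : ℕ → ℝ) (hα0 : α 0 ≠ 0)
    (t : ℕ → ℝ) (x0 : Fin N → ℝ)
    (f : (Fin N → ℝ) → ℝ → (Fin N → ℝ))
    (κ : ℝ) (hκ : 0 < κ)
    (hLip : ∀ x y s, euclNorm (f x s - f y s) ≤ κ * euclNorm (x - y))
    (h : ℝ) (hdef : h = |α 0| - |β 0| * κ * Δt)
    (hstab : |β 0| * κ * Δt < |α 0|)
    (ε γ : ℕ → ℝ)
    (hε : ∀ ℓ, ε ℓ = |β ℓ| * Δt / h)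
    (hγ : ∀ ℓ, γ ℓ = (|α ℓ| + |β ℓ| * κ * Δt) / h)
    (rhat : (ℕ → Fin N → ℝ) → (Fin N → ℝ))
    (hrhat : ∀ y, rhat y = ∑ ℓ ∈ Finset.Icc 1 k,
      ((β ℓ * Δt) • f (x0 + y ℓ) (t ℓ) - α ℓ • y ℓ))
    (x : ℕ → Fin N → ℝ)
    (hFOM : α 0 • x 0 = (β 0 * Δt) • f (x0 + x 0) (t 0) + rhat x)
    (xh : ℕ → Fin p → ℝ)
    (hcons : α 0 • (C * Φ).mulVec (xh 0)
      = (β 0 * Δt) • C.mulVec (f (x0 + Φ.mulVec (xh 0)) (t 0))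
        + C.mulVec (rhat (fun ℓ => Φ.mulVec (xh ℓ))))
    (r : ℕ) (hr : r = (C * Φ).rank)
    (U : Matrix (Fin Nb) (Fin r) ℝ) (Sg : Matrix (Fin r) (Fin r) ℝ)
    (V : Matrix (Fin p) (Fin r) ℝ)
    (hU : Uᵀ * U = 1) (hV : Vᵀ * V = 1)
    (hSdiag : ∀ i j : Fin r, i ≠ j → Sg i j = 0)
    (hSpos : ∀ i : Fin r, 0 < Sg i i)
    (hSVD : C * Φ = U * Sg * Vᵀ)
    (Vb : Matrix (Fin N) (Fin r) ℝ) (hVb : Vb = Φ * V)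
    (Z : Matrix (Fin N) (Fin (N - r)) ℝ)
    (hZ : Zᵀ * Z = 1) (hZV : Zᵀ * Vb = 0)
    (hdecomp : Vb * Vbᵀ + Z * Zᵀ = 1)
    (e : ℕ → Fin N → ℝ) (he : ∀ m, e m = x m - Φ.mulVec (xh m))
    (ζ : ℝ) (hζ : ζ = matNorm (Sg⁻¹ * Uᵀ * C)) :
    euclNorm (Vbᵀ.mulVec (e 0)) ≤
      (∑ ℓ ∈ Finset.range (k + 1), ε ℓ * (κ * euclNorm (Zᵀ.mulVec (e ℓ))
        + ζ * euclNorm ((1 - Φ * Φᵀ).mulVec (f (x0 + Φ.mulVec (xh ℓ)) (t ℓ)))))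
      + ∑ ℓ ∈ Finset.Icc 1 k, γ ℓ * euclNorm (Vbᵀ.mulVec (e ℓ)) := by
  subst hζ hVb hdef
  have hdet : IsUnit Sg.det := by
    have hdiag : Sg = diagonal fun i ↦ Sg i i := by
      ext i j
      by_cases hij : i = j
      · simp [hij]
      · simp [hij, hSdiag i j hij]
    rw [hdiag, det_diagonal, isUnit_iff_ne_zero]
    exact prod_ne_zero_iff.2 fun i _ ↦ (hSpos i).ne'
  set A := Sg⁻¹ * Uᵀ * C with hA
  have hAΦ : A * Φ = Vᵀ := by
    rw [hA, Matrix.mul_assoc, hSVD, Matrix.mul_assoc, Matrix.mul_assoc U, ← Matrix.mul_assoc Uᵀ,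
      hU, Matrix.one_mul, nonsing_inv_mul_cancel_left _ _ hdet]
  have hVΦ : (Φ * V)ᵀ * Φ = Vᵀ := by
    rw [transpose_mul, Matrix.mul_assoc, hΦ, Matrix.mul_one]
  have hAcomp : A = (Φ * V)ᵀ + A * (1 - Φ * Φᵀ) := by
    rw [Matrix.mul_sub, ← Matrix.mul_assoc, hAΦ, transpose_mul, Matrix.mul_one,
      add_sub_cancel]
  have hw : ∀ ℓ, (Φ * V)ᵀ *ᵥ e ℓ = (Φ * V)ᵀ *ᵥ x ℓ - A *ᵥ (Φ *ᵥ xh ℓ) := fun ℓ ↦ by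
    rw [he, mulVec_sub, mulVec_mulVec, mulVec_mulVec, hVΦ, hAΦ]
  have hFOM' : α 0 • ((Φ * V)ᵀ *ᵥ x 0) = (β 0 * Δt) • ((Φ * V)ᵀ *ᵥ f (x0 + x 0) (t 0))
      + ∑ ℓ ∈ Icc 1 k, ((β ℓ * Δt) • ((Φ * V)ᵀ *ᵥ f (x0 + x ℓ) (t ℓ))
        - α ℓ • ((Φ * V)ᵀ *ᵥ x ℓ)) := by
    simpa only [hrhat, mulVec_smul, mulVec_add, mulVec_sum, mulVec_sub] using
      congrArg ((Φ * V)ᵀ *ᵥ ·) hFOM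
  have hcons' : α 0 • (A *ᵥ (Φ *ᵥ xh 0)) = (β 0 * Δt) • (A *ᵥ f (x0 + Φ *ᵥ xh 0) (t 0))
      + ∑ ℓ ∈ Icc 1 k, ((β ℓ * Δt) • (A *ᵥ f (x0 + Φ *ᵥ xh ℓ) (t ℓ))
        - α ℓ • (A *ᵥ (Φ *ᵥ xh ℓ))) := by
    have := congrArg ((Sg⁻¹ * Uᵀ) *ᵥ ·) hcons
    simpa only [hrhat, mulVec_smul, mulVec_add, mulVec_sum, mulVec_sub, mulVec_mulVec,
      ← Matrix.mul_assoc, ← hA] using this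
  have hmain := euclNorm_le_of_multistep (k := k) hΔt.le hstab
    (w := fun ℓ ↦ (Φ * V)ᵀ *ᵥ e ℓ)
    (q := fun ℓ ↦ (Φ * V)ᵀ *ᵥ f (x0 + x ℓ) (t ℓ) - A *ᵥ f (x0 + Φ *ᵥ xh ℓ) (t ℓ))
    (b := fun ℓ ↦ κ * euclNorm (Zᵀ *ᵥ e ℓ)
      + matNorm A * euclNorm ((1 - Φ * Φᵀ) *ᵥ f (x0 + Φ *ᵥ xh ℓ) (t ℓ))) ?_ ?_
  · simpa only [hε, hγ] using hmain
  · simp only [hw, smul_sub]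
    rw [hFOM', hcons', add_sub_add_comm, ← sum_sub_distrib]
    congr 1
    exact sum_congr rfl fun ℓ _ ↦ sub_sub_sub_comm _ _ _ _
  · intro ℓ
    set d := f (x0 + x ℓ) (t ℓ) - f (x0 + Φ *ᵥ xh ℓ) (t ℓ) with hd
    have hq : (Φ * V)ᵀ *ᵥ f (x0 + x ℓ) (t ℓ) - A *ᵥ f (x0 + Φ *ᵥ xh ℓ) (t ℓ) =
        (Φ * V)ᵀ *ᵥ d - A *ᵥ ((1 - Φ * Φᵀ) *ᵥ f (x0 + Φ *ᵥ xh ℓ) (t ℓ)) := by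
      conv_lhs => rw [hAcomp]
      rw [add_mulVec, mulVec_mulVec, hd, mulVec_sub, sub_sub]
    have hVd : euclNorm ((Φ * V)ᵀ *ᵥ d) ≤ euclNorm d :=
      abs_le_of_sq_le_sq' (by
        rw [euclNorm_sq_eq_of_mul_transpose_add hdecomp d]
        exact le_add_of_nonneg_right (sq_nonneg _)) (euclNorm_nonneg d) |>.2
    have hd_le : euclNorm d ≤ κ * euclNorm (e ℓ) := by
      simpa only [he, add_sub_add_left_eq_sub] using hLip (x0 + x ℓ) (x0 + Φ *ᵥ xh ℓ) (t ℓ)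
    have he_le : euclNorm (e ℓ) ≤ euclNorm ((Φ * V)ᵀ *ᵥ e ℓ) + euclNorm (Zᵀ *ᵥ e ℓ) := by
      have hV0 := euclNorm_nonneg ((Φ * V)ᵀ *ᵥ e ℓ)
      have hZ0 := euclNorm_nonneg (Zᵀ *ᵥ e ℓ)
      refine (abs_le_of_sq_le_sq' ?_ (add_nonneg hV0 hZ0)).2
      rw [euclNorm_sq_eq_of_mul_transpose_add hdecomp (e ℓ)]
      nlinarith [mul_nonneg hV0 hZ0]
    rw [hq]
    have hκe := mul_le_mul_of_nonneg_left he_le hκ.le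
    linarith [euclNorm_sub_le ((Φ * V)ᵀ *ᵥ d)
        (A *ᵥ ((1 - Φ * Φᵀ) *ᵥ f (x0 + Φ *ᵥ xh ℓ) (t ℓ))),
      euclNorm_mulVec_le A ((1 - Φ * Φᵀ) *ᵥ f (x0 + Φ *ᵥ xh ℓ) (t ℓ))]
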